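/- Let k, h ≥ 1, let u ∈ F_n^k be a unitary, and suppose that w := u_h* u* u_h belongs to F_n^h. Let λ_u and λ_w be unital *-homomorphisms A → A with λ_u(Sᵢ) = uSᵢ and λ_w(Sᵢ) = wSᵢ for all i, and assume A is generated by S₁,…,Sₙ. Then λ_u ∘ λ_w = id_A = λ_w ∘ λ_u; in particular λ_u is an automorphism of A with inverse λ_w. -/

import Mathlib

noncomputable section CuntzSetup

/-- The word `S_μ = S_{μ₁} ⋯ S_{μ_k}` associated to a multi-index `μ ∈ {1,…,n}^k`. -/
def cuntzWord {A : Type*} [Monoid A] {n k : ℕ} (S : Fin n → A) (μ : Fin k → Fin n) : A :=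
  (List.ofFn fun i => S (μ i)).prod

/-- The canonical shift `φ(x) = ∑ᵢ Sᵢ x Sᵢ*`. -/
def cuntzPhi {A : Type*} [Ring A] [StarRing A] {n : ℕ} (S : Fin n → A) (x : A) : A :=
  ∑ i, S i * x * star (S i)

/-- `u_k = u φ(u) φ²(u) ⋯ φ^{k-1}(u)`. -/
def cuntzUk {A : Type*} [Ring A] [StarRing A] {n : ℕ} (S : Fin n → A) (u : A) (k : ℕ) : A :=
  ((List.range k).map fun j => (cuntzPhi S)^[j] u).prod

/-- `F_n^k`, the linear span of `{S_μ S_ν* : |μ| = |ν| = k}`. -/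
def cuntzF {A : Type*} [Ring A] [StarRing A] [Algebra ℂ A] {n : ℕ} (S : Fin n → A) (k : ℕ) :
    Submodule ℂ A :=
  Submodule.span ℂ {x | ∃ μ ν : Fin k → Fin n, x = cuntzWord S μ * star (cuntzWord S ν)}

end CuntzSetup

section CuntzAux

section Algebraic

theorem cuntzWord_succ {A : Type*} [Monoid A] {n k : ℕ} {S : Fin n → A}
    (μ : Fin (k + 1) → Fin n) :
    cuntzWord S μ = S (μ 0) * cuntzWord S (fun i => μ i.succ) := by
  simp [cuntzWord, List.ofFn_succ]

variable {A : Type*} [Ring A] [StarRing A] {n : ℕ} {S : Fin n → A}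

theorem cuntzPhi_one (hcuntz : ∑ i, S i * star (S i) = 1) : cuntzPhi S 1 = 1 := by
  simpa [cuntzPhi] using hcuntz

theorem cuntzPhi_star (x : A) : cuntzPhi S (star x) = star (cuntzPhi S x) := by
  simp [cuntzPhi, mul_assoc]

theorem cuntzPhi_mul_gen (horth : ∀ i j, star (S i) * S j = if i = j then 1 else 0)
    (x : A) (j : Fin n) : cuntzPhi S x * S j = S j * x := by
  simp [cuntzPhi, Finset.sum_mul, mul_assoc, horth]

theorem cuntzPhi_mul (horth : ∀ i j, star (S i) * S j = if i = j then 1 else 0)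
    (x y : A) : cuntzPhi S (x * y) = cuntzPhi S x * cuntzPhi S y := by
  conv_rhs => rw [cuntzPhi.eq_def S y, Finset.mul_sum]
  simp only [← mul_assoc, cuntzPhi_mul_gen horth]
  simp [cuntzPhi, mul_assoc]

theorem cuntzPhi_mem_unitary (hcuntz : ∑ i, S i * star (S i) = 1)
    (horth : ∀ i j, star (S i) * S j = if i = j then 1 else 0)
    {u : A} (hu : u ∈ unitary A) : cuntzPhi S u ∈ unitary A := by
  rw [Unitary.mem_iff] at hu ⊢
  rw [← cuntzPhi_star, ← cuntzPhi_mul horth, ← cuntzPhi_mul horth, hu.1, hu.2]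
  exact ⟨cuntzPhi_one hcuntz, cuntzPhi_one hcuntz⟩

@[simp]
theorem cuntzUk_zero (u : A) : cuntzUk S u 0 = 1 := by simp [cuntzUk]

theorem cuntzUk_succ' (u : A) (k : ℕ) :
    cuntzUk S u (k + 1) = cuntzUk S u k * (cuntzPhi S)^[k] u := by
  simp [cuntzUk, List.range_succ]

theorem cuntzUk_succ (hcuntz : ∑ i, S i * star (S i) = 1)
    (horth : ∀ i j, star (S i) * S j = if i = j then 1 else 0) (u : A) (k : ℕ) :
    cuntzUk S u (k + 1) = u * cuntzPhi S (cuntzUk S u k) := by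
  induction k with
  | zero => simp [cuntzUk_succ', cuntzPhi_one hcuntz]
  | succ k ih =>
    conv_rhs => rw [cuntzUk_succ', cuntzPhi_mul horth, ← mul_assoc, ← ih]
    rw [cuntzUk_succ', Function.iterate_succ_apply']

theorem cuntzUk_mem_unitary (hcuntz : ∑ i, S i * star (S i) = 1)
    (horth : ∀ i j, star (S i) * S j = if i = j then 1 else 0)
    {u : A} (hu : u ∈ unitary A) (k : ℕ) : cuntzUk S u k ∈ unitary A := by
  induction k with
  | zero => simp
  | succ k ih =>
    rw [cuntzUk_succ hcuntz horth]
    exact mul_mem hu (cuntzPhi_mem_unitary hcuntz horth ih)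

variable [Algebra ℂ A]

theorem cuntzF_zero : cuntzF S 0 = Submodule.span ℂ {1} := by
  simp [cuntzF, cuntzWord]

theorem gen_mul_mul_star_gen_mem_cuntzF {k : ℕ} {x : A} (hx : x ∈ cuntzF S k) (i j : Fin n) :
    S i * x * star (S j) ∈ cuntzF S (k + 1) := by
  induction hx using Submodule.span_induction with
  | mem x hx =>
    obtain ⟨μ, ν, rfl⟩ := hx
    refine Submodule.subset_span ⟨Fin.cons i μ, Fin.cons j ν, ?_⟩
    simp [cuntzWord_succ, mul_assoc]
  | zero => simp
  | add x y _ _ hx hy => simpa [mul_add, add_mul] using add_mem hx hy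
  | smul c x _ hx => simpa using Submodule.smul_mem _ c hx

theorem cuntzF_succ (k : ℕ) : cuntzF S (k + 1) =
    Submodule.span ℂ {x | ∃ i j, ∃ y ∈ cuntzF S k, x = S i * y * star (S j)} := by
  refine le_antisymm (Submodule.span_mono ?_) (Submodule.span_le.2 ?_)
  · rintro _ ⟨μ, ν, rfl⟩
    refine ⟨μ 0, ν 0, _, Submodule.subset_span ⟨fun i => μ i.succ, fun i => ν i.succ, rfl⟩, ?_⟩
    simp [cuntzWord_succ, mul_assoc]
  · rintro _ ⟨i, j, y, hy, rfl⟩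
    exact gen_mul_mul_star_gen_mem_cuntzF hy i j

theorem cuntzPhi_mem_cuntzF {k : ℕ} {x : A} (hx : x ∈ cuntzF S k) :
    cuntzPhi S x ∈ cuntzF S (k + 1) :=
  sum_mem fun i _ => gen_mul_mul_star_gen_mem_cuntzF hx i i

theorem cuntzF_le_succ (hcuntz : ∑ i, S i * star (S i) = 1) (k : ℕ) :
    cuntzF S k ≤ cuntzF S (k + 1) := by
  induction k with
  | zero =>
    rw [cuntzF_zero, Submodule.span_le, Set.singleton_subset_iff, SetLike.mem_coe,
      ← cuntzPhi_one hcuntz]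
    exact cuntzPhi_mem_cuntzF (by rw [cuntzF_zero]; exact Submodule.mem_span_singleton_self 1)
  | succ k ih =>
    rw [cuntzF_succ k, Submodule.span_le]
    rintro _ ⟨i, j, y, hy, rfl⟩
    exact gen_mul_mul_star_gen_mem_cuntzF (ih hy) i j

theorem cuntzF_mono (hcuntz : ∑ i, S i * star (S i) = 1) : Monotone (cuntzF S) :=
  monotone_nat_of_le_succ (cuntzF_le_succ hcuntz)

theorem one_mem_cuntzF (hcuntz : ∑ i, S i * star (S i) = 1) (k : ℕ) : (1 : A) ∈ cuntzF S k :=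
  cuntzF_mono hcuntz (Nat.zero_le k) <| by
    rw [cuntzF_zero]; exact Submodule.mem_span_singleton_self 1

theorem mul_mem_cuntzF (horth : ∀ i j, star (S i) * S j = if i = j then 1 else 0) {k : ℕ}
    {x y : A} (hx : x ∈ cuntzF S k) (hy : y ∈ cuntzF S k) : x * y ∈ cuntzF S k := by
  suffices h : cuntzF S k * cuntzF S k ≤ cuntzF S k from h (Submodule.mul_mem_mul hx hy)
  clear hx hy
  induction k with
  | zero => simp [cuntzF_zero, Submodule.span_mul_span]
  | succ k ih =>
    conv_lhs => rw [cuntzF_succ, Submodule.span_mul_span]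
    rw [Submodule.span_le]
    rintro _ ⟨_, ⟨i, j, y, hy, rfl⟩, _, ⟨l, m, z, hz, rfl⟩, rfl⟩
    have key : S i * y * star (S j) * (S l * z * star (S m)) =
        S i * (y * (star (S j) * S l) * z) * star (S m) := by simp only [mul_assoc]
    simp only [SetLike.mem_coe, key, horth]
    split_ifs
    · rw [mul_one]
      exact gen_mul_mul_star_gen_mem_cuntzF (ih (Submodule.mul_mem_mul hy hz)) i m
    · simp

theorem cuntzUk_mem_cuntzF (hcuntz : ∑ i, S i * star (S i) = 1)
    (horth : ∀ i j, star (S i) * S j = if i = j then 1 else 0) {h : ℕ} {w : A}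
    (hw : w ∈ cuntzF S h) (k : ℕ) : cuntzUk S w k ∈ cuntzF S (h + k) := by
  induction k with
  | zero => simpa using one_mem_cuntzF hcuntz h
  | succ k ih =>
    rw [cuntzUk_succ hcuntz horth]
    exact mul_mem_cuntzF horth (cuntzF_mono hcuntz (by omega) hw) (cuntzPhi_mem_cuntzF ih)

/-- On `F_n^k` the endomorphism `λ_u` is conjugation by `u_k`. -/
theorem map_eq_conj_of_mem_cuntzF (hcuntz : ∑ i, S i * star (S i) = 1)
    (horth : ∀ i j, star (S i) * S j = if i = j then 1 else 0) {u : A} (l : A →⋆ₐ[ℂ] A)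
    (hl : ∀ i, l (S i) = u * S i) {k : ℕ} {x : A} (hx : x ∈ cuntzF S k) :
    l x = cuntzUk S u k * x * star (cuntzUk S u k) := by
  have hword : ∀ {k : ℕ} (μ : Fin k → Fin n),
      l (cuntzWord S μ) = cuntzUk S u k * cuntzWord S μ := by
    intro k
    induction k with
    | zero => simp [cuntzWord]
    | succ k ih =>
      intro μ
      rw [cuntzWord_succ, map_mul, ih, hl, cuntzUk_succ hcuntz horth, mul_assoc u, mul_assoc u,
        ← mul_assoc (cuntzPhi S _), cuntzPhi_mul_gen horth, mul_assoc (S _)]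
  induction hx using Submodule.span_induction with
  | mem x hx =>
    obtain ⟨μ, ν, rfl⟩ := hx
    simp [hword, map_star, mul_assoc]
  | zero => simp
  | add x y _ _ hx hy => simp [hx, hy, mul_add, add_mul]
  | smul c x _ hx => simp [hx]

theorem star_mem_cuntzF [StarModule ℂ A] {k : ℕ} {x : A} (hx : x ∈ cuntzF S k) : star x ∈ cuntzF S k := by
  induction hx using Submodule.span_induction with
  | mem x hx =>
    obtain ⟨μ, ν, rfl⟩ := hx
    exact Submodule.subset_span ⟨ν, μ, by simp⟩
  | zero => simp
  | add x y _ _ hx hy => simpa using add_mem hx hy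
  | smul c x _ hx => simpa using Submodule.smul_mem _ (star c) hx

end Algebraic

/-- Isometries satisfying the Cuntz relation have orthogonal ranges. -/
theorem star_gen_mul_gen_of_cuntz {A : Type*} [CStarAlgebra A] {n : ℕ} {S : Fin n → A}
    (hiso : ∀ i, star (S i) * S i = 1) (hcuntz : ∑ i, S i * star (S i) = 1) (i j : Fin n) :
    star (S i) * S j = if i = j then 1 else 0 := by
  let _ : PartialOrder A := CStarAlgebra.spectralOrder A
  have : StarOrderedRing A := CStarAlgebra.spectralOrderedRing A
  split_ifs with hij
  · rw [hij, hiso]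
  have hsum : ∑ i, star (star (S i) * S j) * (star (S i) * S j) = 1 := by
    calc _ = star (S j) * (∑ i, S i * star (S i)) * S j := by
          simp [Finset.mul_sum, Finset.sum_mul, mul_assoc]
      _ = 1 := by rw [hcuntz, mul_one, hiso]
  rw [← Finset.add_sum_erase _ _ (Finset.mem_univ j), hiso, star_one, one_mul,
    add_eq_left, Finset.sum_eq_zero_iff_of_nonneg fun _ _ => star_mul_self_nonneg _] at hsum
  exact CStarRing.star_mul_self_eq_zero_iff _ |>.1 (hsum i (by simp [hij]))

open scoped CStarAlgebra in
theorem starAlgHom_apply_eq_self_of_generators {A : Type*} [CStarAlgebra A] {s : Set A}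
    (hgen : (StarAlgebra.adjoin ℂ s).topologicalClosure = ⊤) (f : A →⋆ₐ[ℂ] A)
    (hf : ∀ x ∈ s, f x = x) (a : A) : f a = a := by
  have hcont : Continuous f := map_continuous f
  have hle : StarAlgebra.adjoin ℂ s ≤ StarAlgHom.equalizer f (StarAlgHom.id ℂ A) :=
    StarAlgebra.adjoin_le hf
  have hclosed : IsClosed (StarAlgHom.equalizer f (StarAlgHom.id ℂ A) : Set A) :=
    isClosed_eq hcont continuous_id
  have := StarSubalgebra.topologicalClosure_minimal hle hclosed
  rw [hgen] at this
  exact this (Set.mem_univ a)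

end CuntzAux

/-- if `u ∈ F_n^k` is unitary and `w := u_h* u* u_h ∈ F_n^h`, then
`λ_u ∘ λ_w = id = λ_w ∘ λ_u`; in particular `λ_u` is an automorphism with
inverse `λ_w`. -/
theorem stmt6 {A : Type*} [NormedRing A] [StarRing A] [CStarRing A]
    [CompleteSpace A] [NormedAlgebra ℂ A] [StarModule ℂ A]
    {n : ℕ} (hn : 2 ≤ n) (S : Fin n → A)
    (hiso : ∀ i, star (S i) * S i = 1)
    (hcuntz : ∑ i, S i * star (S i) = 1)
    (hgen : (StarAlgebra.adjoin ℂ (Set.range S)).topologicalClosure = ⊤)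
    (k h : ℕ) (hk : 1 ≤ k) (hh : 1 ≤ h)
    (u : A) (huF : u ∈ cuntzF S k) (hu : u ∈ unitary A)
    (hwF : star (cuntzUk S u h) * star u * cuntzUk S u h ∈ cuntzF S h)
    (lu lw : A →⋆ₐ[ℂ] A)
    (hlu : ∀ i, lu (S i) = u * S i)
    (hlw : ∀ i, lw (S i) = (star (cuntzUk S u h) * star u * cuntzUk S u h) * S i) :
    (∀ a : A, lu (lw a) = a) ∧ (∀ a : A, lw (lu a) = a) ∧
      Function.Bijective (lu : A → A) := by
  let _ : CStarAlgebra A := {}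
  have horth := star_gen_mul_gen_of_cuntz hiso hcuntz
  have hU : ∀ m, cuntzUk S u m ∈ unitary A := cuntzUk_mem_unitary hcuntz horth hu
  set w := star (cuntzUk S u h) * star u * cuntzUk S u h with hw
  have hlw_w : lu w = star u := by
    rw [map_eq_conj_of_mem_cuntzF hcuntz horth lu hlu hwF, hw]
    simp only [mul_assoc, Unitary.mul_star_self_of_mem (hU h), mul_one]
    rw [← mul_assoc, Unitary.mul_star_self_of_mem (hU h), one_mul]
  have hleft : ∀ a, lu (lw a) = a := by
    refine starAlgHom_apply_eq_self_of_generators hgen (lu.comp lw) ?_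
    rintro _ ⟨i, rfl⟩
    rw [StarAlgHom.comp_apply, hlw, map_mul, hlw_w, hlu, ← mul_assoc,
      Unitary.star_mul_self_of_mem hu, one_mul]
  have hinj : ∀ x ∈ cuntzF S (h + k), lu x = 0 → x = 0 := by
    intro x hx h0
    rw [map_eq_conj_of_mem_cuntzF hcuntz horth lu hlu hx] at h0
    have hx' : x = star (cuntzUk S u (h + k)) *
        (cuntzUk S u (h + k) * x * star (cuntzUk S u (h + k))) * cuntzUk S u (h + k) := by
      simp only [mul_assoc, Unitary.star_mul_self_of_mem (hU (h + k)), mul_one]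
      rw [← mul_assoc, Unitary.star_mul_self_of_mem (hU (h + k)), one_mul]
    rw [hx', h0, mul_zero, zero_mul]
  have hlwu : lw u = star w := by
    have hWk := cuntzUk_mem_cuntzF hcuntz horth hwF k
    refine sub_eq_zero.1 (hinj _ (sub_mem ?_ ?_) ?_)
    · rw [map_eq_conj_of_mem_cuntzF hcuntz horth lw hlw huF]
      exact mul_mem_cuntzF horth (mul_mem_cuntzF horth hWk
        (cuntzF_mono hcuntz (Nat.le_add_left k h) huF)) (star_mem_cuntzF hWk)
    · exact cuntzF_mono hcuntz (Nat.le_add_right h k) (star_mem_cuntzF hwF)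
    · rw [map_sub, hleft, map_star, hlw_w, star_star, sub_self]
  have hwU : w ∈ unitary A :=
    mul_mem (mul_mem (Unitary.star_mem (hU h)) (Unitary.star_mem hu)) (hU h)
  have hright : ∀ a, lw (lu a) = a := by
    refine starAlgHom_apply_eq_self_of_generators hgen (lw.comp lu) ?_
    rintro _ ⟨i, rfl⟩
    rw [StarAlgHom.comp_apply, hlu, map_mul, hlwu, hlw, ← mul_assoc,
      Unitary.star_mul_self_of_mem hwU, one_mul]
  exact ⟨hleft, hright, Function.bijective_iff_has_inverse.2 ⟨lw, hright, hleft⟩⟩
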